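/- arXiv:2505.22359 — 2 statements merged into one kernel-verified Lean document; each statement's English description precedes it below -/
import Mathlib

section
/- Let k ≥ 2, p ∈ [2,∞], and let ℓ̃ : ℝ^{k−1} → ℝ be a nonnegative differentiable function that is β-smooth with respect to the L_p norm. Then for every y ∈ {1,…,k}, every W, W′ ∈ ℝ^{k×d} with ‖W − W′‖_F ≤ R, and every x ∈ ℝ^d with ‖x‖₂ ≤ 1, ℓ̃(D_y W x) ≤ 2 ℓ̃(D_y W′ x) + 2 β k^{2/p} R². -/
open Real Filter MeasureTheory Finset
open scoped ENNReal

/-- The `L_p` norm of a vector in `ℝ^m`, for `p ∈ [1,∞]` (as an `ℝ≥0∞` parameter). -/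
noncomputable def pnorm (p : ℝ≥0∞) {m : ℕ} (v : Fin m → ℝ) : ℝ :=
  ‖(WithLp.equiv p (Fin m → ℝ)).symm v‖

/-- The gradient of `f : ℝ^m → ℝ`, as the vector of partial derivatives. -/
noncomputable def grad {m : ℕ} (f : (Fin m → ℝ) → ℝ) (w : Fin m → ℝ) : Fin m → ℝ :=
  fun i => fderiv ℝ f w (Pi.single i 1)

/-- The Frobenius norm of a `k × d` matrix. -/
noncomputable def frob {k d : ℕ} (A : Fin k → Fin d → ℝ) : ℝ :=
  Real.sqrt (∑ i, ∑ j, A i j ^ 2)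

/-- The gradient of a function of a `k × d` matrix, as the matrix of partial derivatives. -/
noncomputable def gradM {k d : ℕ} (f : (Fin k → Fin d → ℝ) → ℝ) (W : Fin k → Fin d → ℝ) :
    Fin k → Fin d → ℝ :=
  fun i j => fderiv ℝ f W (Pi.single i (Pi.single j 1))

/-- The increasing enumeration of `{0, …, k-1} \ {y}` by `Fin (k-1)`. -/
def skipIdx {k : ℕ} (y : Fin k) (j : Fin (k - 1)) : Fin k :=
  if (j : ℕ) < (y : ℕ) then ⟨j, by have := j.isLt; omega⟩
  else ⟨(j : ℕ) + 1, by have := j.isLt; omega⟩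

/-- The linear map `D_y : ℝ^k → ℝ^{k-1}` sending `v` to the vector `(v_y - v_j)_{j ≠ y}`. -/
def Dmap {k : ℕ} (y : Fin k) (v : Fin k → ℝ) : Fin (k - 1) → ℝ :=
  fun j => v y - v (skipIdx y j)

lemma aux_pnorm_top {m : ℕ} (v : Fin m → ℝ) (i : Fin m) : |v i| ≤ pnorm ⊤ v := by
  have := PiLp.norm_apply_le (p := ⊤) ((WithLp.equiv ⊤ (Fin m → ℝ)).symm v) i
  simpa [pnorm] using this

lemma aux_pnorm_fin {p : ℝ≥0∞} (hp : 0 < p.toReal) {m : ℕ} (v : Fin m → ℝ) :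
    pnorm p v = (∑ i, |v i| ^ p.toReal) ^ (1 / p.toReal) := by
  unfold pnorm
  rw [PiLp.norm_eq_sum hp]
  simp

lemma aux_holder {p q : ℝ≥0∞} (hp : 2 ≤ p) (hpq : 1 / p + 1 / q = 1) {m : ℕ}
    (a h : Fin m → ℝ) : ∑ i, a i * h i ≤ pnorm q a * pnorm p h := by
  by_cases hpt : p = ⊤
  · subst hpt
    have hq : q = 1 := by
      have : q⁻¹ = 1 := by simpa using hpq
      simpa using this
    subst hq
    rw [aux_pnorm_fin (by simp)]
    simp only [ENNReal.toReal_one, Real.rpow_one, div_one]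
    rw [Finset.sum_mul]
    refine Finset.sum_le_sum fun i _ => ?_
    calc a i * h i ≤ |a i * h i| := le_abs_self _
      _ = |a i| * |h i| := abs_mul _ _
      _ ≤ _ := mul_le_mul_of_nonneg_left (aux_pnorm_top h i) (abs_nonneg _)
  · have h2 : (2:ℝ) ≤ p.toReal := by
      have := (ENNReal.toReal_le_toReal (by simp) hpt).2 hp
      simpa using this
    have hq0 : q ≠ 0 := by
      rintro rfl
      simp at hpq
    have hinv : p.toReal⁻¹ + q.toReal⁻¹ = 1 := by
      have := congrArg ENNReal.toReal hpq
      rw [ENNReal.toReal_add (by simp; rintro rfl; simp at hp) (by simpa using hq0)] at this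
      simpa using this
    have hc : p.toReal.HolderConjugate q.toReal :=
      Real.holderConjugate_iff.2 ⟨by linarith, hinv⟩
    rw [aux_pnorm_fin hc.symm.pos, aux_pnorm_fin hc.pos]
    exact Real.inner_le_Lp_mul_Lq Finset.univ a h hc.symm

lemma aux_bound {p : ℝ≥0∞} (hp : 2 ≤ p) {m : ℕ} (h : Fin m → ℝ) (k : ℕ) (hk : m ≤ k)
    (C : ℝ) (hC : 0 ≤ C) (hh : ∀ i, |h i| ≤ C) :
    pnorm p h ^ 2 ≤ (k : ℝ) ^ (2 / p.toReal) * C ^ 2 := by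
  by_cases hpt : p = ⊤
  · subst hpt
    have h1 : pnorm ⊤ h ≤ C := by
      unfold pnorm
      rw [PiLp.norm_eq_ciSup]
      exact Real.iSup_le (by simpa using hh) hC
    have h0 : 0 ≤ pnorm ⊤ h := norm_nonneg _
    simp only [ENNReal.toReal_top, div_zero, Real.rpow_zero, one_mul]
    gcongr
  · have h2 : (2:ℝ) ≤ p.toReal := by
      have := (ENNReal.toReal_le_toReal (by simp) hpt).2 hp
      simpa using this
    have hr : 0 < p.toReal := by linarith
    have h1 : pnorm p h ≤ (k : ℝ) ^ (1 / p.toReal) * C := by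
      rw [aux_pnorm_fin hr]
      calc (∑ i, |h i| ^ p.toReal) ^ (1 / p.toReal)
          ≤ ((k : ℝ) * C ^ p.toReal) ^ (1 / p.toReal) := by
            apply Real.rpow_le_rpow (by positivity) _ (by positivity)
            calc ∑ i, |h i| ^ p.toReal ≤ ∑ i : Fin m, C ^ p.toReal :=
                  Finset.sum_le_sum fun i _ => Real.rpow_le_rpow (abs_nonneg _) (hh i) hr.le
              _ = (m : ℝ) * C ^ p.toReal := by simp
              _ ≤ _ := by gcongr
        _ = _ := by
            rw [Real.mul_rpow (by positivity) (by positivity), ← Real.rpow_mul hC,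
              mul_one_div_cancel hr.ne', Real.rpow_one]
    have h0 : 0 ≤ pnorm p h := by
      rw [aux_pnorm_fin hr]; positivity
    calc pnorm p h ^ 2 ≤ ((k : ℝ) ^ (1 / p.toReal) * C) ^ 2 := by gcongr
      _ = _ := by
        rw [mul_pow, ← Real.rpow_natCast, ← Real.rpow_mul (by positivity)]
        congr 2
        push_cast; ring

lemma aux_smul {p : ℝ≥0∞} (hp : 2 ≤ p) {m : ℕ} (h : Fin m → ℝ) (t : ℝ) :
    pnorm p (t • h) = |t| * pnorm p h := by
  haveI : Fact (1 ≤ p) := ⟨le_trans (by norm_num) hp⟩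
  unfold pnorm
  rw [← Real.norm_eq_abs, ← norm_smul]
  rfl

lemma aux_fderiv {m : ℕ} (f : (Fin m → ℝ) → ℝ) (w h : Fin m → ℝ) :
    fderiv ℝ f w h = ∑ i, grad f w i * h i := by
  conv_lhs => rw [pi_eq_sum_univ' h]
  rw [map_sum]
  refine Finset.sum_congr rfl fun i _ => ?_
  rw [map_smul, smul_eq_mul, mul_comm]
  unfold grad
  congr 2

lemma aux_descent {p q : ℝ≥0∞} (hp : 2 ≤ p) (hpq : 1 / p + 1 / q = 1) {m : ℕ}
    (β : ℝ) (f : (Fin m → ℝ) → ℝ) (hdiff : Differentiable ℝ f)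
    (hsmooth : ∀ u v, pnorm q (grad f u - grad f v) ≤ β * pnorm p (u - v))
    (v h : Fin m → ℝ) :
    f (v + h) ≤ f v + fderiv ℝ f v h + β * pnorm p h ^ 2 / 2 := by
  haveI : Fact (1 ≤ p) := ⟨le_trans (by norm_num) hp⟩
  have hn : 0 ≤ pnorm p h := norm_nonneg _
  set L := β * pnorm p h ^ 2 with hL
  let g : ℝ → ℝ := fun t => f (v + t • h) - (fderiv ℝ f v h * t + L / 2 * t ^ 2)
  have hg : ∀ t, HasDerivAt g (fderiv ℝ f (v + t • h) h - (fderiv ℝ f v h + L * t)) t := by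
    intro t
    have h1 : HasDerivAt (fun t : ℝ => v + t • h) h t := by
      simpa using ((hasDerivAt_id t).smul_const h).const_add v
    have h2 := (hdiff (v + t • h)).hasFDerivAt.comp_hasDerivAt t h1
    have h3 : HasDerivAt (fun t : ℝ => fderiv ℝ f v h * t + L / 2 * t ^ 2)
        (fderiv ℝ f v h + L * t) t := by
      have := ((hasDerivAt_id' t).const_mul (fderiv ℝ f v h)).add
        ((hasDerivAt_pow 2 t).const_mul (L / 2))
      refine this.congr_deriv ?_
      push_cast
      ring
    exact h2.sub h3
  have hanti : AntitoneOn g (Set.Icc 0 1) := by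
    apply antitoneOn_of_deriv_nonpos (convex_Icc 0 1)
    · exact fun t _ => (hg t).continuousAt.continuousWithinAt
    · exact fun t _ => (hg t).differentiableAt.differentiableWithinAt
    · intro t ht
      rw [interior_Icc] at ht
      rw [(hg t).deriv]
      have e : fderiv ℝ f (v + t • h) h - fderiv ℝ f v h
          = ∑ i, (grad f (v + t • h) - grad f v) i * h i := by
        rw [aux_fderiv, aux_fderiv, ← Finset.sum_sub_distrib]
        simp [sub_mul]
      have b1 := aux_holder hp hpq (grad f (v + t • h) - grad f v) h
      have b2 := hsmooth (v + t • h) v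
      rw [add_sub_cancel_left, aux_smul hp, abs_of_pos ht.1] at b2
      have b3 := mul_le_mul_of_nonneg_right b2 hn
      have : β * (t * pnorm p h) * pnorm p h = L * t := by rw [hL]; ring
      linarith
  have := hanti (by simp : (0:ℝ) ∈ Set.Icc (0:ℝ) 1) (by simp : (1:ℝ) ∈ Set.Icc (0:ℝ) 1) (by simp)
  simp only [g, one_smul, zero_smul, add_zero] at this
  linarith

lemma aux_ne {k : ℕ} (y : Fin k) (j : Fin (k - 1)) : y ≠ skipIdx y j := by
  intro h
  have := congrArg Fin.val h
  unfold skipIdx at this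
  split_ifs at this with h1 <;> simp at this <;> omega

lemma aux_coord {k d : ℕ} (y : Fin k) (R : ℝ) (A : Fin k → Fin d → ℝ) (hA : frob A ≤ R)
    (x : Fin d → ℝ) (hx : pnorm 2 x ≤ 1) (j : Fin (k - 1)) :
    |Dmap y (fun i => ∑ t, A i t * x t) j| ≤ √2 * R := by
  have hR : 0 ≤ R := (Real.sqrt_nonneg _).trans hA
  have hA2 : ∑ i, ∑ j, A i j ^ 2 ≤ R ^ 2 := (Real.sqrt_le_left hR).1 hA
  have hx2 : ∑ t, x t ^ 2 ≤ 1 := by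
    have e : pnorm 2 x = √(∑ t, x t ^ 2) := by
      unfold pnorm
      rw [EuclideanSpace.norm_eq]; simp
    rw [e] at hx
    simpa using hx
  have hu : ∑ i, (∑ t, A i t * x t) ^ 2 ≤ R ^ 2 := by
    refine le_trans (Finset.sum_le_sum fun i _ => ?_) hA2
    refine (Finset.sum_mul_sq_le_sq_mul_sq _ _ _).trans ?_
    exact mul_le_of_le_one_right (Finset.sum_nonneg fun _ _ => sq_nonneg _) hx2
  set u : Fin k → ℝ := fun i => ∑ t, A i t * x t with hudef
  have hpair : u y ^ 2 + u (skipIdx y j) ^ 2 ≤ R ^ 2 := by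
    rw [← Finset.sum_pair (f := fun i => u i ^ 2) (aux_ne y j)]
    exact (Finset.sum_le_sum_of_subset_of_nonneg (Finset.subset_univ _)
      fun _ _ _ => sq_nonneg _).trans hu
  apply abs_le_of_sq_le_sq _ (by positivity)
  rw [mul_pow, Real.sq_sqrt (by norm_num)]
  unfold Dmap
  nlinarith [sq_nonneg (u y + u (skipIdx y j))]

/-- if the template `ℓ̃` is nonnegative, differentiable and `β`-smooth w.r.t.
the `L_p` norm (`p ∈ [2,∞]`), then for `‖W - W'‖_F ≤ R` and `‖x‖₂ ≤ 1`,
`ℓ̃(D_y W x) ≤ 2 ℓ̃(D_y W' x) + 2 β k^{2/p} R²`. -/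
theorem statement4 {k d : ℕ} (hk : 2 ≤ k)
    (p q : ℝ≥0∞) (hp : 2 ≤ p) (hpq : 1 / p + 1 / q = 1)
    (β : ℝ) (ltil : (Fin (k - 1) → ℝ) → ℝ)
    (hnonneg : ∀ u, 0 ≤ ltil u)
    (hdiff : Differentiable ℝ ltil)
    (hsmooth : ∀ u v, pnorm q (grad ltil u - grad ltil v) ≤ β * pnorm p (u - v))
    (y : Fin k) (R : ℝ) (W W' : Fin k → Fin d → ℝ) (hWW' : frob (W - W') ≤ R)
    (x : Fin d → ℝ) (hx : pnorm 2 x ≤ 1) :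
    ltil (Dmap y (fun i => ∑ t, W i t * x t)) ≤
      2 * ltil (Dmap y (fun i => ∑ t, W' i t * x t)) +
        2 * β * (k : ℝ) ^ (2 / p.toReal) * R ^ 2 := by
  haveI : Fact (1 ≤ p) := ⟨le_trans (by norm_num) hp⟩
  have hR : 0 ≤ R := (Real.sqrt_nonneg _).trans hWW'
  have hβ : 0 ≤ β := by
    let e : Fin (k - 1) → ℝ := Pi.single ⟨0, by omega⟩ 1
    have h1 := hsmooth e 0
    have hq : 1 ≤ q := by
      by_contra hq
      have : 1 < 1 / q := by simpa using hq
      have h3 : 1 / q ≤ 1 := le_add_self.trans hpq.le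
      exact absurd this (not_lt.2 h3)
    haveI : Fact (1 ≤ q) := ⟨hq⟩
    have h0 : 0 ≤ pnorm q (grad ltil e - grad ltil 0) := norm_nonneg _
    have hpos : 0 < pnorm p (e - 0) := by
      rw [sub_zero]
      have := PiLp.norm_apply_le (p := p) ((WithLp.equiv p (Fin (k-1) → ℝ)).symm e) ⟨0, by omega⟩
      have h5 : (1:ℝ) ≤ pnorm p e := by simpa [pnorm, e] using this
      linarith
    exact nonneg_of_mul_nonneg_left (h0.trans h1) hpos
  set v := Dmap y (fun i => ∑ t, W' i t * x t) with hv
  set h := Dmap y (fun i => ∑ t, (W - W') i t * x t) with hh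
  have hsum : Dmap y (fun i => ∑ t, W i t * x t) = v + h := by
    ext j
    simp only [hv, hh, Dmap, Pi.add_apply, Pi.sub_apply, sub_mul, Finset.sum_sub_distrib]
    ring
  rw [hsum]
  have d1 := aux_descent hp hpq β ltil hdiff hsmooth v h
  have d2 := aux_descent hp hpq β ltil hdiff hsmooth v (-h)
  have hneg : pnorm p (-h) = pnorm p h := by
    have := aux_smul hp h (-1)
    simpa using this
  rw [hneg, map_neg] at d2
  have d3 := hnonneg (v + -h)
  have b := aux_bound hp h k (by omega) (√2 * R) (by positivity)
    (aux_coord y R (W - W') hWW' x hx)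
  rw [mul_pow, Real.sq_sqrt (by norm_num)] at b
  have b2 := mul_le_mul_of_nonneg_left b hβ
  have : β * ((k : ℝ) ^ (2 / p.toReal) * (2 * R ^ 2))
      = 2 * β * (k : ℝ) ^ (2 / p.toReal) * R ^ 2 := by ring
  linarith
end

section
/- Let k ≥ 2, p ∈ [2,∞], and let ℓ̃ : ℝ^{k−1} → ℝ be nonnegative, convex, differentiable and β-smooth with respect to the L_p norm; let ℓ(ŷ, y) = ℓ̃(D_y ŷ). Let S = ((x_1,y_1),…,(x_n,y_n)) with ‖x_i‖₂ ≤ 1 for all i, and let W_1 = 0, W_{t+1} = W_t − η ∇L̂(W_t) be gradient descent on the empirical risk L̂ with step size η ≤ 1/(6 k^{2/p} β). Fix ε > 0 and any W*_ε ∈ ℝ^{k×d} with L̂(W*_ε) ≤ ε. Then for every T ≥ 1: ‖W_T − W*_ε‖_F ≤ ‖W*_ε‖_F + 2√(η ε T) and ‖W_T‖_F ≤ 2‖W*_ε‖_F + 2√(η ε T). -/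
open Real Filter MeasureTheory Finset
open scoped ENNReal

lemma frob_sq' {k d : ℕ} (A : Fin k → Fin d → ℝ) : frob A ^ 2 = ∑ i, ∑ j, A i j ^ 2 :=
  Real.sq_sqrt (Finset.sum_nonneg fun _ _ => Finset.sum_nonneg fun _ _ => sq_nonneg _)

lemma frob_eq_norm {k d : ℕ} (A : Fin k → Fin d → ℝ) :
    frob A = ‖(WithLp.toLp 2 (fun z : Fin k × Fin d => A z.1 z.2) :
      EuclideanSpace ℝ (Fin k × Fin d))‖ := by
  rw [EuclideanSpace.norm_eq, frob, Fintype.sum_prod_type]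
  simp

lemma frob_add_le {k d : ℕ} (A B : Fin k → Fin d → ℝ) : frob (A + B) ≤ frob A + frob B := by
  rw [frob_eq_norm, frob_eq_norm, frob_eq_norm]
  exact norm_add_le (WithLp.toLp 2 (fun z : Fin k × Fin d => A z.1 z.2) :
      EuclideanSpace ℝ (Fin k × Fin d)) (WithLp.toLp 2 (fun z : Fin k × Fin d => B z.1 z.2))

lemma convex_first_order {E : Type*} [NormedAddCommGroup E] [NormedSpace ℝ E] {f : E → ℝ}
    (hc : ConvexOn ℝ Set.univ f) (hd : Differentiable ℝ f) (u v : E) :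
    f u + fderiv ℝ f u (v - u) ≤ f v := by
  have hg : ConvexOn ℝ Set.univ (fun t : ℝ => f (AffineMap.lineMap u v t)) := by
    have := hc.comp_affineMap (AffineMap.lineMap u v : ℝ →ᵃ[ℝ] E)
    rw [Set.preimage_univ] at this
    exact this
  have hd0 : HasDerivAt (fun t : ℝ => f (AffineMap.lineMap u v t)) (fderiv ℝ f u (v - u)) 0 := by
    have h1 : HasFDerivAt f (fderiv ℝ f u) (AffineMap.lineMap u v (0 : ℝ)) := by
      simpa using (hd u).hasFDerivAt
    exact h1.comp_hasDerivAt (0 : ℝ) AffineMap.hasDerivAt_lineMap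
  have := hg.le_slope_of_hasDerivAt (Set.mem_univ 0) (Set.mem_univ 1) one_pos hd0
  simp [slope_def_field] at this
  rw [map_sub]
  linarith

lemma fderiv_eq_grad {m : ℕ} (f : (Fin m → ℝ) → ℝ) (u w : Fin m → ℝ) :
    fderiv ℝ f u w = ∑ j, grad f u j * w j := by
  conv_lhs => rw [← Finset.univ_sum_single w]
  rw [map_sum]
  refine Finset.sum_congr rfl fun j _ => ?_
  have : (Pi.single j (w j) : Fin m → ℝ) = w j • Pi.single j 1 := by
    rw [← Pi.single_smul]; simp
  rw [this, map_smul, grad, smul_eq_mul, mul_comm]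

lemma fderiv_eq_gradM {k d : ℕ} (f : (Fin k → Fin d → ℝ) → ℝ) (W V : Fin k → Fin d → ℝ) :
    fderiv ℝ f W V = ∑ i, ∑ j, gradM f W i j * V i j := by
  have hV : V = ∑ i, ∑ j, V i j • (Pi.single i (Pi.single j 1) : Fin k → Fin d → ℝ) := by
    ext a b
    simp [Finset.sum_apply, Pi.single_apply, Finset.sum_ite_eq, apply_ite, ite_apply]
  conv_lhs => rw [hV]
  simp only [map_sum, map_smul, gradM, smul_eq_mul]
  exact Finset.sum_congr rfl fun i _ => Finset.sum_congr rfl fun j _ => mul_comm _ _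

lemma pnorm_nonneg' (p : ℝ≥0∞) (hp : 1 ≤ p) {m : ℕ} (v : Fin m → ℝ) : 0 ≤ pnorm p v := by
  have : Fact (1 ≤ p) := ⟨hp⟩
  exact norm_nonneg _

lemma holder_pnorm {m : ℕ} (p q : ℝ≥0∞) (hp : 2 ≤ p) (hpq : 1 / p + 1 / q = 1)
    (g w : Fin m → ℝ) : ∑ j, g j * w j ≤ pnorm q g * pnorm p w := by
  by_cases hpt : p = ⊤
  · subst hpt
    have hq : q = 1 := by simpa using hpq
    subst hq
    have h1 : pnorm 1 g = ∑ j, |g j| := by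
      rw [pnorm, PiLp.norm_eq_sum (by simp)]
      simp
    have h2 : ∀ j, |w j| ≤ pnorm ⊤ w := fun j =>
      PiLp.norm_apply_le ((WithLp.equiv ⊤ (Fin m → ℝ)).symm w) j
    rw [h1, Finset.sum_mul]
    refine Finset.sum_le_sum fun j _ => ?_
    calc g j * w j ≤ |g j * w j| := le_abs_self _
      _ = |g j| * |w j| := abs_mul _ _
      _ ≤ _ := mul_le_mul_of_nonneg_left (h2 j) (abs_nonneg _)
  · have hpr : 2 ≤ p.toReal := by
      have := ENNReal.toReal_mono hpt hp
      simpa using this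
    have hp0 : p ≠ 0 := by rintro rfl; simp at hp
    have hq0 : q ≠ 0 := by rintro rfl; simp at hpq
    have hqt : q ≠ ⊤ := by
      rintro rfl
      have : p = 1 := by simpa using hpq
      rw [this] at hp
      norm_num at hp
    have hr : p.toReal⁻¹ + q.toReal⁻¹ = 1 := by
      have := congrArg ENNReal.toReal hpq
      rw [ENNReal.toReal_add (by simp [hp0]) (by simp [hq0])] at this
      simpa using this
    have hqpos : 0 < q.toReal := ENNReal.toReal_pos hq0 hqt
    have hc : q.toReal.HolderConjugate p.toReal :=
      (Real.holderConjugate_iff (p := p.toReal)).2 ⟨by linarith, hr⟩ |>.symm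
    have := Real.inner_le_Lp_mul_Lq Finset.univ g w hc
    rw [pnorm, pnorm, PiLp.norm_eq_sum hqpos, PiLp.norm_eq_sum (by linarith)]
    simpa using this

lemma pnorm_le_of_abs {m k : ℕ} (hmk : m ≤ k) (hk : 1 ≤ k) (p : ℝ≥0∞) (hp : 2 ≤ p) (w : Fin m → ℝ) (R : ℝ)
    (hR : 0 ≤ R) (hw : ∀ j, w j ^ 2 ≤ R) :
    pnorm p w ^ 2 ≤ (k : ℝ) ^ (2 / p.toReal) * R := by
  have hw' : ∀ j, |w j| ≤ √R := fun j => Real.abs_le_sqrt (hw j)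
  by_cases hpt : p = ⊤
  · subst hpt
    have : pnorm ⊤ w ≤ √R := by
      rw [pnorm, PiLp.norm_eq_ciSup]
      exact Real.iSup_le (fun j => by simpa using hw' j) (Real.sqrt_nonneg _)
    have h0 := pnorm_nonneg' ⊤ (by simp) w
    simp only [ENNReal.toReal_top, div_zero, Real.rpow_zero, one_mul]
    calc pnorm ⊤ w ^ 2 ≤ √R ^ 2 := by gcongr
      _ = R := Real.sq_sqrt hR
  · have hpr : 2 ≤ p.toReal := by
      have := ENNReal.toReal_mono hpt hp
      simpa using this
    have hpp : 0 < p.toReal := by linarith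
    have : pnorm p w ≤ (k : ℝ) ^ (1 / p.toReal) * √R := by
      rw [pnorm, PiLp.norm_eq_sum hpp]
      have h1 : ∑ i, ‖((WithLp.equiv p (Fin m → ℝ)).symm w) i‖ ^ p.toReal
          ≤ (k : ℝ) * √R ^ p.toReal := by
        calc _ ≤ ∑ i : Fin m, √R ^ p.toReal :=
              Finset.sum_le_sum fun i _ =>
                Real.rpow_le_rpow (norm_nonneg _) (by simpa using hw' i) hpp.le
          _ = (m : ℝ) * √R ^ p.toReal := by simp
          _ ≤ _ := by gcongr
      calc _ ≤ ((k : ℝ) * √R ^ p.toReal) ^ (1 / p.toReal) :=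
            Real.rpow_le_rpow (Finset.sum_nonneg fun _ _ => by positivity) h1 (by positivity)
        _ = _ := by
            rw [Real.mul_rpow (by positivity) (by positivity), one_div,
              Real.rpow_rpow_inv (Real.sqrt_nonneg _) hpp.ne']
    have h0 := pnorm_nonneg' p (le_trans (by norm_num) hp) w
    calc pnorm p w ^ 2 ≤ ((k : ℝ) ^ (1 / p.toReal) * √R) ^ 2 := by gcongr
      _ = (k : ℝ) ^ (2 / p.toReal) * R := by
          rw [mul_pow, Real.sq_sqrt hR, ← Real.rpow_natCast, ← Real.rpow_mul (by positivity)]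
          congr 2
          push_cast; ring

lemma skipIdx_ne {k : ℕ} (y : Fin k) (j : Fin (k - 1)) : skipIdx y j ≠ y := by
  intro h
  have := congrArg Fin.val h
  unfold skipIdx at this
  split_ifs at this with h1 <;> simp at this <;> omega

/-- The linear map `W ↦ D_y (W x)`. -/
noncomputable def Amap {k d : ℕ} (y : Fin k) (x : Fin d → ℝ) :
    (Fin k → Fin d → ℝ) →L[ℝ] (Fin (k - 1) → ℝ) :=
  LinearMap.toContinuousLinearMap
    { toFun := fun W => Dmap y (fun r => ∑ t, W r t * x t)
      map_add' := by
        intro A B; ext j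
        simp [Dmap, add_mul, Finset.sum_add_distrib]; ring
      map_smul' := by
        intro c A; ext j
        simp [Dmap, mul_assoc, ← Finset.mul_sum]; ring }

lemma Amap_apply {k d : ℕ} (y : Fin k) (x : Fin d → ℝ) (W : Fin k → Fin d → ℝ) :
    Amap y x W = Dmap y (fun r => ∑ t, W r t * x t) := rfl

lemma Amap_bound {k d : ℕ} (hk : 2 ≤ k) (p : ℝ≥0∞) (hp : 2 ≤ p) (y : Fin k) (x : Fin d → ℝ)
    (hx : pnorm 2 x ≤ 1) (V : Fin k → Fin d → ℝ) :
    pnorm p (Amap y x V) ^ 2 ≤ (k : ℝ) ^ (2 / p.toReal) * (2 * ∑ i, ∑ j, V i j ^ 2) := by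
  have hx2 : ∑ t, x t ^ 2 ≤ 1 := by
    have h : pnorm 2 x = √(∑ t, x t ^ 2) := by
      rw [pnorm, PiLp.norm_eq_of_L2]; simp
    rw [h] at hx
    simpa using ((Real.sqrt_le_iff).1 hx).2
  have hrow : ∀ r, (∑ t, V r t * x t) ^ 2 ≤ ∑ t, V r t ^ 2 := fun r =>
    (Finset.sum_mul_sq_le_sq_mul_sq _ _ _).trans
      (mul_le_of_le_one_right (Finset.sum_nonneg fun _ _ => sq_nonneg _) hx2)
  have h0 : ∀ i, 0 ≤ ∑ j, V i j ^ 2 := fun i => Finset.sum_nonneg fun _ _ => sq_nonneg _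
  refine pnorm_le_of_abs (by omega) (by omega) p hp _ _
    (mul_nonneg two_pos.le (Finset.sum_nonneg fun i _ => h0 i)) fun j => ?_
  rw [Amap_apply]
  have h2 := Finset.sum_le_sum_of_subset_of_nonneg
    (Finset.subset_univ ({y, skipIdx y j} : Finset (Fin k))) (fun i _ _ => h0 i)
  rw [Finset.sum_pair (skipIdx_ne y j).symm] at h2
  have h3 := hrow y
  have h4 := hrow (skipIdx y j)
  unfold Dmap
  nlinarith [sq_nonneg ((∑ t, V y t * x t) + ∑ t, V (skipIdx y j) t * x t)]

/-- norm bounds for the iterates of gradient descent on the empirical risk of a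
multiclass loss with nonnegative, convex template that is `β`-smooth w.r.t. the `L_p` norm
(`p ∈ [2,∞]`), with step size `η ≤ 1/(6 k^{2/p} β)`: for any `W*_ε` with `L̂(W*_ε) ≤ ε` and any
`T ≥ 1`, `‖W_T - W*_ε‖_F ≤ ‖W*_ε‖_F + 2√(ηεT)` and `‖W_T‖_F ≤ 2‖W*_ε‖_F + 2√(ηεT)`. -/
theorem statement5 {k d n : ℕ} (hk : 2 ≤ k) (hn : 1 ≤ n)
    (p q : ℝ≥0∞) (hp : 2 ≤ p) (hpq : 1 / p + 1 / q = 1)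
    (β : ℝ) (ltil : (Fin (k - 1) → ℝ) → ℝ)
    (hnonneg : ∀ u, 0 ≤ ltil u)
    (hconv : ConvexOn ℝ Set.univ ltil)
    (hdiff : Differentiable ℝ ltil)
    (hsmooth : ∀ u v, pnorm q (grad ltil u - grad ltil v) ≤ β * pnorm p (u - v))
    (x : Fin n → Fin d → ℝ) (y : Fin n → Fin k) (hx : ∀ i, pnorm 2 (x i) ≤ 1)
    (Lhat : (Fin k → Fin d → ℝ) → ℝ)
    (hLhat : Lhat = fun W => (1 / n : ℝ) * ∑ i, ltil (Dmap (y i) (fun r => ∑ t, W r t * x i t)))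
    (η : ℝ) (hη0 : 0 < η) (hη : η ≤ 1 / (6 * (k : ℝ) ^ (2 / p.toReal) * β))
    (W : ℕ → Fin k → Fin d → ℝ) (hW1 : W 1 = 0)
    (hWrec : ∀ t, 1 ≤ t → W (t + 1) = W t - η • gradM Lhat (W t))
    (ε : ℝ) (hε : 0 < ε) (Wε : Fin k → Fin d → ℝ) (hWε : Lhat Wε ≤ ε) :
    ∀ T, 1 ≤ T →
      frob (W T - Wε) ≤ frob Wε + 2 * Real.sqrt (η * ε * T) ∧
      frob (W T) ≤ 2 * frob Wε + 2 * Real.sqrt (η * ε * T) := by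
  have hβ : 0 < β := by
    by_contra h
    push Not at h
    have : 1 / (6 * (k : ℝ) ^ (2 / p.toReal) * β) ≤ 0 :=
      div_nonpos_of_nonneg_of_nonpos zero_le_one
        (mul_nonpos_of_nonneg_of_nonpos (by positivity) h)
    linarith
  have hn' : (0 : ℝ) < n := by exact_mod_cast hn
  have hk' : (0 : ℝ) < k := by exact_mod_cast (by omega : 0 < k)
  set K : ℝ := (k : ℝ) ^ (2 / p.toReal) with hK
  have hKpos : 0 < K := Real.rpow_pos_of_pos hk' _
  have hLA : Lhat = fun W => (1 / n : ℝ) * ∑ i, ltil (Amap (y i) (x i) W) := hLhat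
  have hder : ∀ V, HasFDerivAt Lhat
      ((1 / n : ℝ) • ∑ i, (fderiv ℝ ltil (Amap (y i) (x i) V)).comp (Amap (y i) (x i))) V := by
    intro V
    rw [hLA]
    refine HasFDerivAt.const_mul (HasFDerivAt.fun_sum fun i _ => ?_) _
    exact (hdiff _).hasFDerivAt.comp V (Amap (y i) (x i)).hasFDerivAt
  have hfd : ∀ V U, fderiv ℝ Lhat V U =
      (1 / n : ℝ) * ∑ i, fderiv ℝ ltil (Amap (y i) (x i) V) (Amap (y i) (x i) U) := by
    intro V U
    rw [(hder V).fderiv]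
    simp
  have hL0 : ∀ V, 0 ≤ Lhat V := by
    intro V
    rw [hLA]
    exact mul_nonneg (by positivity) (Finset.sum_nonneg fun i _ => hnonneg _)
  have hcx : ∀ U V, Lhat U + fderiv ℝ Lhat U (V - U) ≤ Lhat V := by
    intro U V
    rw [hfd, hLA]
    simp only
    rw [← mul_add, ← Finset.sum_add_distrib]
    refine mul_le_mul_of_nonneg_left (Finset.sum_le_sum fun i _ => ?_) (by positivity)
    rw [map_sub]
    exact convex_first_order hconv hdiff _ _
  have hsm : ∀ U V, fderiv ℝ Lhat U (U - V) - fderiv ℝ Lhat V (U - V)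
      ≤ β * (K * (2 * ∑ i, ∑ j, (U - V) i j ^ 2)) := by
    intro U V
    rw [hfd, hfd, ← mul_sub, ← Finset.sum_sub_distrib]
    have hb : ∀ i, fderiv ℝ ltil (Amap (y i) (x i) U) (Amap (y i) (x i) (U - V))
        - fderiv ℝ ltil (Amap (y i) (x i) V) (Amap (y i) (x i) (U - V))
        ≤ β * (K * (2 * ∑ i, ∑ j, (U - V) i j ^ 2)) := by
      intro i
      rw [fderiv_eq_grad, fderiv_eq_grad, ← Finset.sum_sub_distrib]
      have h1 := holder_pnorm p q hp hpq
        (grad ltil (Amap (y i) (x i) U) - grad ltil (Amap (y i) (x i) V))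
        (Amap (y i) (x i) (U - V))
      have h2 := hsmooth (Amap (y i) (x i) U) (Amap (y i) (x i) V)
      rw [← map_sub] at h2
      have h3 := Amap_bound hk p hp (y i) (x i) (hx i) (U - V)
      have h4 := pnorm_nonneg' p (le_trans (by norm_num) hp) (Amap (y i) (x i) (U - V))
      calc _ = ∑ j, (grad ltil (Amap (y i) (x i) U) - grad ltil (Amap (y i) (x i) V)) j
              * Amap (y i) (x i) (U - V) j :=
            Finset.sum_congr rfl fun j _ => by rw [Pi.sub_apply, sub_mul]
        _ ≤ _ := h1
        _ ≤ (β * pnorm p (Amap (y i) (x i) (U - V))) * pnorm p (Amap (y i) (x i) (U - V)) :=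
            mul_le_mul_of_nonneg_right h2 h4
        _ = β * pnorm p (Amap (y i) (x i) (U - V)) ^ 2 := by ring
        _ ≤ _ := mul_le_mul_of_nonneg_left h3 hβ.le
    calc _ ≤ (1 / n : ℝ) * ∑ i : Fin n, β * (K * (2 * ∑ i, ∑ j, (U - V) i j ^ 2)) :=
          mul_le_mul_of_nonneg_left (Finset.sum_le_sum fun i _ => hb i) (by positivity)
      _ = _ := by
          rw [Finset.sum_const, Finset.card_univ, Fintype.card_fin, nsmul_eq_mul]
          field_simp
  have hself : ∀ U, η * frob (gradM Lhat U) ^ 2 ≤ 2 * Lhat U := by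
    intro U
    set G := gradM Lhat U with hG
    have hGG : fderiv ℝ Lhat U G = frob G ^ 2 := by
      rw [fderiv_eq_gradM, frob_sq']
      exact Finset.sum_congr rfl fun i _ => Finset.sum_congr rfl fun j _ => by rw [sq]
    set s : ℝ := 1 / (4 * K * β) with hs
    have hspos : 0 < s := by positivity
    have h1 := hcx (U - s • G) U
    have h2 := hsm U (U - s • G)
    have h3 := hL0 (U - s • G)
    have e : U - (U - s • G) = s • G := by abel
    rw [e] at h1 h2
    have e2 : ∑ i, ∑ j, (s • G) i j ^ 2 = s ^ 2 * frob G ^ 2 := by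
      rw [frob_sq']
      simp [mul_pow, Finset.mul_sum]
    rw [e2, map_smul (fderiv ℝ Lhat U), hGG, smul_eq_mul] at h2
    have h4 : s * frob G ^ 2 - β * (K * (2 * (s ^ 2 * frob G ^ 2))) ≤ Lhat U := by linarith
    have e3 : s * frob G ^ 2 - β * (K * (2 * (s ^ 2 * frob G ^ 2))) = s / 2 * frob G ^ 2 := by
      rw [hs]; field_simp; ring
    rw [e3] at h4
    have h5 : η ≤ s := by
      refine hη.trans ?_
      rw [hs]
      apply one_div_le_one_div_of_le (by positivity)
      nlinarith [mul_pos hKpos hβ]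
    nlinarith [mul_le_mul_of_nonneg_right h5 (sq_nonneg (frob G))]
  have hstep : ∀ t, 1 ≤ t → frob (W (t + 1) - Wε) ^ 2 ≤ frob (W t - Wε) ^ 2 + 2 * η * ε := by
    intro t ht
    have e : frob (W (t + 1) - Wε) ^ 2 = frob (W t - Wε) ^ 2
        + 2 * η * fderiv ℝ Lhat (W t) (Wε - W t) + η ^ 2 * frob (gradM Lhat (W t)) ^ 2 := by
      rw [hWrec t ht, fderiv_eq_gradM, frob_sq', frob_sq', frob_sq']
      simp only [Finset.mul_sum, ← Finset.sum_add_distrib]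
      refine Finset.sum_congr rfl fun i _ => Finset.sum_congr rfl fun j _ => ?_
      simp only [Pi.sub_apply, Pi.smul_apply, smul_eq_mul]
      ring
    have h1 := hcx (W t) Wε
    have h2 := mul_le_mul_of_nonneg_left (hself (W t)) hη0.le
    have h3 : 2 * η * fderiv ℝ Lhat (W t) (Wε - W t) ≤ 2 * η * (ε - Lhat (W t)) :=
      mul_le_mul_of_nonneg_left (by linarith) (by positivity)
    rw [e]
    nlinarith
  have hneg : frob (W 1 - Wε) = frob Wε := by
    rw [hW1]; simp [frob]
  have hall : ∀ T : ℕ, 1 ≤ T → frob (W T - Wε) ^ 2 ≤ frob Wε ^ 2 + 2 * η * ε * T := by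
    intro T hT
    induction T, hT using Nat.le_induction with
    | base => rw [hneg]; have : 0 < 2 * η * ε * ((1 : ℕ) : ℝ) := by positivity
              linarith
    | succ t ht ih =>
      have := hstep t ht
      push_cast
      nlinarith
  intro T hT
  have hA : 0 ≤ frob Wε := Real.sqrt_nonneg _
  have hB : 0 ≤ √(η * ε * T) := Real.sqrt_nonneg _
  have hBs : √(η * ε * T) ^ 2 = η * ε * T := Real.sq_sqrt (by positivity)
  have hfirst : frob (W T - Wε) ≤ frob Wε + 2 * √(η * ε * T) := by
    refine abs_le_of_sq_le_sq' ?_ (by positivity) |>.2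
    have := hall T hT
    nlinarith [mul_nonneg hA hB, sq_nonneg (√(η * ε * T))]
  refine ⟨hfirst, ?_⟩
  have h := frob_add_le (W T - Wε) Wε
  rw [sub_add_cancel] at h
  linarith
end
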